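/- Under Assumptions 1 and 2 with L = 1, for all z = (x,v), z' = (x',v') ∈ ℝ^{2d}, writing E_t and E_t' for the block matrices of Lemma 4.1 associated to the trajectories from z and z' respectively: ‖∇Φ_t(z) − E_t − (∇Φ_t(z') − E_t')‖_F ≤ (7/20) L_H t³ (2|x − x'| + t|v − v'|). In particular: ‖∇_x Φ_t¹(z) − ∇_x Φ_t¹(z')‖_F ≤ (7/10)t²L_H|x−x'| + (21/40)t³L_H|v−v'|; ‖∇_v Φ_t¹(z) − ∇_v Φ_t¹(z')‖_F ≤ (7/10)t³L_H|x−x'| + (7/20)t⁴L_H|v−v'|; ‖∇_x Φ_t²(z) − ∇_x Φ_t²(z')‖_F ≤ (21/20)tL_H|x−x'| + (21/40)t²L_H|v−v'|; ‖∇_v Φ_t²(z) − ∇_v Φ_t²(z')‖_F ≤ (21/40)t²L_H|x−x'| + (11/30)t³L_H|v−v'|. -/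

import Mathlib

open MeasureTheory Real Set

noncomputable section

abbrev Ed (d : ℕ) := EuclideanSpace ℝ (Fin d)
abbrev Phase (d : ℕ) := Ed d × Ed d

/-- Standard Gaussian measure `N(0, I_d)` on `ℝ^d`, defined by normalising the density
`exp (-‖v‖²/2)` with respect to the Lebesgue measure. -/
def stdGaussian (d : ℕ) : Measure (Ed d) :=
  ((volume.withDensity fun v : Ed d => ENNReal.ofReal (Real.exp (-‖v‖ ^ 2 / 2))) Set.univ)⁻¹ •
    volume.withDensity fun v : Ed d => ENNReal.ofReal (Real.exp (-‖v‖ ^ 2 / 2))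

/-- The probability measure with density proportional to `exp (-U)`. -/
def gibbs {d : ℕ} (U : Ed d → ℝ) : Measure (Ed d) :=
  ((volume.withDensity fun x => ENNReal.ofReal (Real.exp (-U x))) Set.univ)⁻¹ •
    volume.withDensity fun x => ENNReal.ofReal (Real.exp (-U x))

/-- The equilibrium measure `μ = π ⊗ N(0, I_d)` on phase space. -/
def eqMeasure {d : ℕ} (U : Ed d → ℝ) : Measure (Phase d) := (gibbs U).prod (stdGaussian d)

/-- Relative entropy `Ent(ν|μ) = ∫ ln (dν/dμ) dν`. -/
def relEnt {α : Type*} [MeasurableSpace α] (ν μ : Measure α) : ℝ :=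
  ∫ z, Real.log ((ν.rnDeriv μ z).toReal) ∂ν

/-- Gradient in the position variable. -/
def gradX {d : ℕ} (h : Phase d → ℝ) (z : Phase d) : Ed d := gradient (fun x => h (x, z.2)) z.1

/-- Gradient in the velocity variable. -/
def gradV {d : ℕ} (h : Phase d → ℝ) (z : Phase d) : Ed d := gradient (fun v => h (z.1, v)) z.2

/-- `h` is a (nonnegative, C¹) density of `ν` with respect to `μ` on phase space. -/
def IsDensityOf {d : ℕ} (h : Phase d → ℝ) (ν μ : Measure (Phase d)) : Prop :=
  (∀ z, 0 ≤ h z) ∧ ContDiff ℝ 1 h ∧ ν = μ.withDensity fun z => ENNReal.ofReal (h z)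

/-- `h` is a (nonnegative, C¹) density of `ν` with respect to `μ` on `ℝ^m`. -/
def IsDensityOfE {m : ℕ} (h : Ed m → ℝ) (ν μ : Measure (Ed m)) : Prop :=
  (∀ x, 0 ≤ h x) ∧ ContDiff ℝ 1 h ∧ ν = μ.withDensity fun x => ENNReal.ofReal (h x)

/-- Logarithmic Sobolev inequality with constant `C` for a measure on `ℝ^d`, in the
functional form `∫ g ln g dπ ≤ C ∫ |∇g|²/g dπ` over C¹ probability densities `g`. -/
def HasLSI {d : ℕ} (pm : Measure (Ed d)) (C : ℝ) : Prop :=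
  ∀ g : Ed d → ℝ, ContDiff ℝ 1 g → (∀ x, 0 ≤ g x) → (∫ x, g x ∂pm) = 1 →
    ∫ x, g x * Real.log (g x) ∂pm ≤ C * ∫ x, ‖gradient g x‖ ^ 2 / g x ∂pm

/-- `G`-Poincaré inequality with constant `C`:  `∫ G(g) dπ ≤ C ∫ G''(g)|∇g|² dπ`. -/
def HasGPoincare {d : ℕ} (pm : Measure (Ed d)) (G : ℝ → ℝ) (C : ℝ) : Prop :=
  ∀ g : Ed d → ℝ, ContDiff ℝ 1 g → (∀ x, 0 ≤ g x) → (∫ x, g x ∂pm) = 1 →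
    ∫ x, G (g x) ∂pm ≤ C * ∫ x, iteratedDeriv 2 G (g x) * ‖gradient g x‖ ^ 2 ∂pm

/-- One transition `ν ↦ νP` of the idealized HMC chain `P = D_η H_t`: the velocity is
refreshed (`v ↦ ηv + √(1-η²) G`) and then the Hamiltonian flow `Φ` is followed for time `t`. -/
def stepP {d : ℕ} (Φ : ℝ → Phase d → Phase d) (t η : ℝ) (ν : Measure (Phase d)) :
    Measure (Phase d) :=
  ν.bind fun z => (stdGaussian d).map fun g => Φ t (z.1, η • z.2 + Real.sqrt (1 - η ^ 2) • g)

/-- One transition `ν ↦ νQ` of the chain `Q = D_η H_t D_η`. -/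
def stepQ {d : ℕ} (Φ : ℝ → Phase d → Phase d) (t η : ℝ) (ν : Measure (Phase d)) :
    Measure (Phase d) :=
  ν.bind fun z => ((stdGaussian d).prod (stdGaussian d)).map fun gg =>
    ((Φ t (z.1, η • z.2 + Real.sqrt (1 - η ^ 2) • gg.1)).1,
      η • (Φ t (z.1, η • z.2 + Real.sqrt (1 - η ^ 2) • gg.1)).2 +
        Real.sqrt (1 - η ^ 2) • gg.2)

/-- One transition `ν ↦ νP_θ` of the HMC chain with random integration time `t ∼ θ`. -/
def stepPtheta {d : ℕ} (Φ : ℝ → Phase d → Phase d) (η : ℝ) (θ : Measure ℝ)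
    (ν : Measure (Phase d)) : Measure (Phase d) :=
  ν.bind fun z => θ.bind fun t =>
    (stdGaussian d).map fun g => Φ t (z.1, η • z.2 + Real.sqrt (1 - η ^ 2) • g)

/-- The modified entropy `L(ν) = Ent(ν|μ) + a ∫ |∇_x h + ∇_v h|²/h dμ`, expressed through a
density `h` of `ν` with respect to `μ`. -/
def modEnt {d : ℕ} (μ : Measure (Phase d)) (a : ℝ) (h : Phase d → ℝ) : ℝ :=
  (∫ z, h z * Real.log (h z) ∂μ) + a * ∫ z, ‖gradX h z + gradV h z‖ ^ 2 / h z ∂μ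

/-- The modified `G`-entropy `L_G(ν) = ∫ G(h) dμ + a ∫ G''(h)|∇_x h + ∇_v h|² dμ`. -/
def modEntG {d : ℕ} (μ : Measure (Phase d)) (G : ℝ → ℝ) (a : ℝ) (h : Phase d → ℝ) : ℝ :=
  (∫ z, G (h z) ∂μ) + a * ∫ z, iteratedDeriv 2 G (h z) * ‖gradX h z + gradV h z‖ ^ 2 ∂μ

/-- The `G`-Fisher information `I_G(ν|μ) = ∫ G''(h)|∇h|² dμ` on phase space. -/
def fisherG {d : ℕ} (μ : Measure (Phase d)) (G : ℝ → ℝ) (h : Phase d → ℝ) : ℝ :=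
  ∫ z, iteratedDeriv 2 G (h z) * (‖gradX h z‖ ^ 2 + ‖gradV h z‖ ^ 2) ∂μ

/-- Squared Euclidean norm `|z|² = |x|² + |v|²` on phase space. -/
def normSq {d : ℕ} (z : Phase d) : ℝ := ‖z.1‖ ^ 2 + ‖z.2‖ ^ 2

/-- Squared `L²` Wasserstein distance on phase space (Euclidean cost), as an infimum over
couplings. -/
def W2sq {d : ℕ} (ν μ' : Measure (Phase d)) : ℝ :=
  ⨅ r : {r : Measure (Phase d × Phase d) // r.map Prod.fst = ν ∧ r.map Prod.snd = μ'},
    ∫ p, normSq (p.1 - p.2) ∂(r : Measure (Phase d × Phase d))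

/-- Frobenius norm of a linear map on `ℝ^d`. -/
def frobNorm {d : ℕ} (A : Ed d →L[ℝ] Ed d) : ℝ :=
  Real.sqrt (∑ i, ∑ j, (A (EuclideanSpace.single j 1) i) ^ 2)

/-- Frobenius norm of a linear map on phase space. -/
def frobNormP {d : ℕ} (A : Phase d →L[ℝ] Phase d) : ℝ :=
  Real.sqrt ((∑ j, normSq (A (EuclideanSpace.single j 1, 0))) +
    ∑ j, normSq (A (0, EuclideanSpace.single j 1)))

/-- Block `2×2` continuous linear map on phase space. -/
def blockCLM {d : ℕ} (M11 M12 M21 M22 : Ed d →L[ℝ] Ed d) : Phase d →L[ℝ] Phase d :=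
  ((M11.comp (ContinuousLinearMap.fst ℝ (Ed d) (Ed d))) +
      (M12.comp (ContinuousLinearMap.snd ℝ (Ed d) (Ed d)))).prod
    ((M21.comp (ContinuousLinearMap.fst ℝ (Ed d) (Ed d))) +
      (M22.comp (ContinuousLinearMap.snd ℝ (Ed d) (Ed d))))

/-- One step of the HMC chain driven by the explicit noise `ω = (t, g)`. -/
def chainStep {d : ℕ} (Φ : ℝ → Phase d → Phase d) (η : ℝ) (ω : ℝ × Ed d) (z : Phase d) :
    Phase d :=
  Φ ω.1 (z.1, η • z.2 + Real.sqrt (1 - η ^ 2) • ω.2)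

/-- `n` steps of the HMC chain driven by the explicit noise sequence `ω`. -/
def chainIter {d : ℕ} (Φ : ℝ → Phase d → Phase d) (η : ℝ) :
    (n : ℕ) → (Fin n → ℝ × Ed d) → Phase d → Phase d
  | 0, _, z => z
  | n + 1, ω, z => chainIter Φ η n (fun i => ω i.succ) (chainStep Φ η (ω 0) z)

/-- The convergence rate `ρ` of Theorem 2.1 as a function of the parameters. -/
def rhoHMC (η a t : ℝ) : ℝ :=
  let m₁ := 2 * t - 21 / 10 * t ^ 2
  let m₂ := 1 + η * (-1 + 2 * t + 13 / 5 * t ^ 2)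
  let m₃ := 1 - η ^ 2 * (1 + 2 * t + 31 / 10 * t ^ 2) + (1 - η ^ 2) / (2 * a)
  if η = 0 then (1 - 3 * t) * (m₁ - 2 * a / (2 * a + 1))
  else (1 - 3 * t) * ((m₁ + m₃ * (η⁻¹) ^ 2) / 2 -
    Real.sqrt (m₂ ^ 2 * (η⁻¹) ^ 2 + ((m₁ - m₃ * (η⁻¹) ^ 2) / 2) ^ 2))

/-- The critical depth `c*` of the potential `U`: infimum, over continuous paths `Γ` going
from a local minimum of `U` to a global minimum of `U`, of the maximal elevation gain. -/
def critDepth {d : ℕ} (U : Ed d → ℝ) : ℝ :=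
  sInf {c : ℝ | ∃ Γ : ℝ → Ed d, ContinuousOn Γ (Set.Icc 0 1) ∧ IsLocalMin U (Γ 0) ∧
    (∀ y, U (Γ 1) ≤ U y) ∧ c = sSup ((fun s => U (Γ s)) '' Set.Icc 0 1) - U (Γ 0)}

/-- The function `D_η h` obtained from `h` by the velocity-refreshment operator. -/
def refreshFun {d : ℕ} (η : ℝ) (h : Phase d → ℝ) (z : Phase d) : ℝ :=
  ∫ g, h (z.1, η • z.2 + Real.sqrt (1 - η ^ 2) • g) ∂stdGaussian d

end
/-- The explicit approximation `E_t` of the Jacobian of the Hamiltonian flow, as a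
continuous linear map on phase space. -/
noncomputable def EtCLM {d : ℕ} (U : Ed d → ℝ) (Φ : ℝ → Phase d → Phase d) (t : ℝ) (z : Phase d) :
    Phase d →L[ℝ] Phase d :=
  blockCLM
    (ContinuousLinearMap.id ℝ (Ed d) -
      ∫ s in (0 : ℝ)..t, (t - s) • fderiv ℝ (gradient U) (Φ s z).1)
    (t • ContinuousLinearMap.id ℝ (Ed d))
    (-∫ s in (0 : ℝ)..t, fderiv ℝ (gradient U) (Φ s z).1)
    (ContinuousLinearMap.id ℝ (Ed d) -
      ∫ s in (0 : ℝ)..t, s • fderiv ℝ (gradient U) (Φ s z).1)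

/-- `y` and `w` solve `y' = w`, `w' = F` on the interval `[0, t]`. -/
structure SolvesSecondOrder {V : Type*} [NormedAddCommGroup V] [NormedSpace ℝ V]
    (t : ℝ) (y w F : ℝ → V) : Prop where
  pos : ∀ s ∈ Icc 0 t, HasDerivWithinAt y (w s) (Icc 0 t) s
  vel : ∀ s ∈ Icc 0 t, HasDerivWithinAt w (F s) (Icc 0 t) s

section SecondOrder

variable {V V' : Type*} [NormedAddCommGroup V] [NormedSpace ℝ V]
  [NormedAddCommGroup V'] [NormedSpace ℝ V'] {t : ℝ} {y w F y' w' F' : ℝ → V}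

lemma SolvesSecondOrder.sub (h : SolvesSecondOrder t y w F) (h' : SolvesSecondOrder t y' w' F') :
    SolvesSecondOrder t (fun s => y s - y' s) (fun s => w s - w' s) (fun s => F s - F' s) :=
  ⟨fun s hs => (h.pos s hs).sub (h'.pos s hs), fun s hs => (h.vel s hs).sub (h'.vel s hs)⟩

lemma SolvesSecondOrder.map (L : V →L[ℝ] V') (h : SolvesSecondOrder t y w F) :
    SolvesSecondOrder t (fun s => L (y s)) (fun s => L (w s)) (fun s => L (F s)) :=
  ⟨fun s hs => L.hasFDerivAt.comp_hasDerivWithinAt s (h.pos s hs),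
    fun s hs => L.hasFDerivAt.comp_hasDerivWithinAt s (h.vel s hs)⟩

lemma SolvesSecondOrder.continuousOn (h : SolvesSecondOrder t y w F) :
    ContinuousOn y (Icc 0 t) :=
  fun s hs => (h.pos s hs).continuousWithinAt

lemma norm_sub_le_of_norm_derivWithin_le {G g : ℝ → ℝ} (hG : ∀ s, HasDerivAt G (g s) s)
    (hG0 : G 0 = 0) (hy : ∀ s ∈ Icc 0 t, HasDerivWithinAt y (w s) (Icc 0 t) s) {τ : ℝ}
    (hτ : τ ∈ Icc 0 t) (hw : ∀ s ∈ Icc 0 τ, ‖w s‖ ≤ g s) : ‖y τ - y 0‖ ≤ G τ := by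
  have hsub : Icc 0 τ ⊆ Icc 0 t := Icc_subset_Icc_right hτ.2
  refine image_norm_le_of_norm_deriv_right_le_deriv_boundary (a := 0) (b := τ)
    (f := fun s => y s - y 0) (f' := w) (B := G) (B' := g) ?_ ?_ (by simp [hG0]) hG
    (fun s hs => hw s (Ico_subset_Icc_self hs)) (right_mem_Icc.2 hτ.1)
  · exact fun s hs => (((hy s (hsub hs)).continuousWithinAt).mono hsub).sub
      continuousWithinAt_const
  · intro s hs
    refine ((hy s (hsub (Ico_subset_Icc_self hs))).mono_of_mem_nhdsWithin ?_).sub_const _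
    exact Filter.mem_of_superset (Icc_mem_nhdsGE hs.2)
      (Icc_subset_Icc hs.1 hτ.2)

lemma norm_sub_le_of_norm_derivWithin_le_cubic {p q r u : ℝ}
    (hy : ∀ s ∈ Icc 0 t, HasDerivWithinAt y (w s) (Icc 0 t) s) {τ : ℝ} (hτ : τ ∈ Icc 0 t)
    (hw : ∀ s ∈ Icc 0 τ, ‖w s‖ ≤ p + q * s + r * s ^ 2 + u * s ^ 3) :
    ‖y τ - y 0‖ ≤ p * τ + q * τ ^ 2 / 2 + r * τ ^ 3 / 3 + u * τ ^ 4 / 4 := by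
  refine norm_sub_le_of_norm_derivWithin_le
    (G := fun s => p * s + q * s ^ 2 / 2 + r * s ^ 3 / 3 + u * s ^ 4 / 4) (fun s => ?_)
    (by simp) hy hτ hw
  have := ((((hasDerivAt_id s).const_mul p).add
    (((hasDerivAt_pow 2 s).const_mul q).div_const 2)).add
    (((hasDerivAt_pow 3 s).const_mul r).div_const 3)).add
    (((hasDerivAt_pow 4 s).const_mul u).div_const 4)
  refine this.congr_deriv ?_
  norm_num
  ring

lemma SolvesSecondOrder.norm_sub_sub_le_cubic {p q r u : ℝ} (h : SolvesSecondOrder t y w F)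
    {τ : ℝ} (hτ : τ ∈ Icc 0 t)
    (hF : ∀ s ∈ Icc 0 τ, ‖F s‖ ≤ p + q * s + r * s ^ 2 + u * s ^ 3) :
    ‖y τ - y 0 - τ • w 0‖ ≤
      p * τ ^ 2 / 2 + q * τ ^ 3 / 6 + r * τ ^ 4 / 12 + u * τ ^ 5 / 20 := by
  have key := norm_sub_le_of_norm_derivWithin_le (t := t) (τ := τ)
    (y := fun s => y s - s • w 0) (w := fun s => w s - w 0)
    (G := fun s => p * s ^ 2 / 2 + q * s ^ 3 / 6 + r * s ^ 4 / 12 + u * s ^ 5 / 20)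
    (g := fun s => p * s + q * s ^ 2 / 2 + r * s ^ 3 / 3 + u * s ^ 4 / 4)
    (fun s => ?_) (by simp) ?_ hτ ?_
  · refine le_trans (le_of_eq ?_) key
    simp only [zero_smul, sub_zero]
    congr 1
    abel
  · have := ((((((hasDerivAt_pow 2 s).const_mul p)).div_const 2).add
      (((hasDerivAt_pow 3 s).const_mul q).div_const 6)).add
      (((hasDerivAt_pow 4 s).const_mul r).div_const 12)).add
      (((hasDerivAt_pow 5 s).const_mul u).div_const 20)
    refine this.congr_deriv ?_
    norm_num
    ring
  · intro s hs
    exact ((h.pos s hs).sub ((hasDerivWithinAt_id s (Icc 0 t)).smul_const (w 0))).congr_deriv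
      (by rw [one_smul])
  · intro s hs
    exact norm_sub_le_of_norm_derivWithin_le_cubic h.vel ⟨hs.1, hs.2.trans hτ.2⟩
      fun r hr => hF r ⟨hr.1, hr.2.trans hs.2⟩

/-- Grönwall-type estimate for `y'' = F` with `‖F‖ ≤ ‖y‖ + (cubic source)` on a short interval. -/
lemma SolvesSecondOrder.norm_le {p q r u : ℝ} (h : SolvesSecondOrder t y w F) (ht : t ≤ 1 / 4)
    (hp : 0 ≤ p) (hq : 0 ≤ q) (hr : 0 ≤ r) (hu : 0 ≤ u)
    (hF : ∀ s ∈ Icc 0 t, ‖F s‖ ≤ ‖y s‖ + (p + q * s + r * s ^ 2 + u * s ^ 3)) :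
    ∀ s ∈ Icc 0 t, ‖y s‖ ≤ 32 / 31 * (‖y 0‖ + ‖w 0‖ * s +
      (p * s ^ 2 / 2 + q * s ^ 3 / 6 + r * s ^ 4 / 12 + u * s ^ 5 / 20)) := by
  intro s₀ hs₀
  set g : ℝ → ℝ := fun s => ‖y 0‖ + ‖w 0‖ * s +
      (p * s ^ 2 / 2 + q * s ^ 3 / 6 + r * s ^ 4 / 12 + u * s ^ 5 / 20) with hg
  have hgmono : ∀ a b : ℝ, 0 ≤ a → a ≤ b → g a ≤ g b := by
    intro a b ha hab
    simp only [hg]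
    gcongr
  have hgnn : ∀ a : ℝ, 0 ≤ a → 0 ≤ g a := by
    intro a ha
    simp only [hg]
    positivity
  obtain ⟨τ, hτ, hmax⟩ := isCompact_Icc.exists_isMaxOn (s := Icc 0 t) ⟨s₀, hs₀⟩
    (f := fun s => ‖y s‖ - 32 / 31 * g s)
    ((h.continuousOn.norm).sub (by fun_prop))
  set M := ‖y τ‖ - 32 / 31 * g τ with hM
  have hle : ∀ s ∈ Icc 0 t, ‖y s‖ ≤ M + 32 / 31 * g s := fun s hs => by
    have := hmax hs
    simp only [mem_ofPred_eq] at this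
    linarith
  suffices hM0 : M ≤ 0 by
    have := hle s₀ hs₀
    simp only [hg] at this
    linarith
  have hbound := h.norm_sub_sub_le_cubic (p := M + 32 / 31 * g τ + p) (q := q) (r := r) (u := u) hτ
    fun s hs => by
      have hst : s ∈ Icc 0 t := ⟨hs.1, hs.2.trans hτ.2⟩
      have h1 := hF s hst
      have h2 := hle s hst
      have h3 := hgmono s τ hs.1 hs.2
      linarith
  have htri : ‖y τ‖ ≤ ‖y τ - y 0 - τ • w 0‖ + ‖y 0‖ + ‖τ • w 0‖ := by
    have h1 : y τ = (y τ - y 0 - τ • w 0) + y 0 + τ • w 0 := by abel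
    conv_lhs => rw [h1]
    exact norm_add₃_le
  rw [norm_smul, Real.norm_of_nonneg hτ.1] at htri
  have hτ2 : τ ^ 2 ≤ 1 / 16 := by nlinarith [hτ.1, hτ.2]
  have hgτ := hgnn τ hτ.1
  have hyτ : 0 ≤ M + 32 / 31 * g τ := by rw [hM]; simp
  have h5 : ‖y τ‖ ≤ (M + 32 / 31 * g τ) * τ ^ 2 / 2 + g τ := by
    simp only [hg] at hbound ⊢
    linarith
  have h6 : (M + 32 / 31 * g τ) * τ ^ 2 ≤ (M + 32 / 31 * g τ) * (1 / 16) := by gcongr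
  linarith

/-- A priori bounds for `y'' = F` with `‖F‖ ≤ ‖y‖` on a short interval. -/
lemma SolvesSecondOrder.norm_le_and_norm_sub_sub_le (h : SolvesSecondOrder t y w F)
    (ht : t ≤ 1 / 4) (hF : ∀ s ∈ Icc 0 t, ‖F s‖ ≤ ‖y s‖) :
    ∀ s ∈ Icc 0 t, ‖y s‖ ≤ (1 + 16 / 31 * s ^ 2) * (‖y 0‖ + ‖w 0‖ * s) ∧
      ‖y s - y 0 - s • w 0‖ ≤ 16 / 31 * s ^ 2 * (‖y 0‖ + ‖w 0‖ * s) := by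
  have h1 : ∀ s ∈ Icc 0 t, ‖y s‖ ≤ 32 / 31 * (‖y 0‖ + ‖w 0‖ * s) := by
    intro s hs
    simpa using h.norm_le (p := 0) (q := 0) (r := 0) (u := 0) ht le_rfl le_rfl le_rfl le_rfl
      (by simpa using hF) s hs
  intro s hs
  have h2 : ‖y s - y 0 - s • w 0‖ ≤ 16 / 31 * s ^ 2 * (‖y 0‖ + ‖w 0‖ * s) := by
    refine (h.norm_sub_sub_le_cubic (p := 32 / 31 * ‖y 0‖) (q := 32 / 31 * ‖w 0‖) (r := 0)
      (u := 0) hs fun r hr => ?_).trans ?_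
    · have hr' : r ∈ Icc 0 t := ⟨hr.1, hr.2.trans hs.2⟩
      linarith [hF r hr', h1 r hr']
    · have : 0 ≤ ‖w 0‖ * s ^ 3 := mul_nonneg (norm_nonneg _) (pow_nonneg hs.1 3)
      linarith
  refine ⟨?_, h2⟩
  have h3 : ‖y s‖ ≤ ‖y s - y 0 - s • w 0‖ + ‖y 0‖ + ‖s • w 0‖ := by
    have h4 : y s = (y s - y 0 - s • w 0) + y 0 + s • w 0 := by abel
    conv_lhs => rw [h4]
    exact norm_add₃_le
  rw [norm_smul, Real.norm_of_nonneg hs.1] at h3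
  linarith

lemma exists_solvesSecondOrder_linear [CompleteSpace V] (ht0 : 0 < t) (ht : t ≤ 1 / 4)
    {K : ℝ → V →L[ℝ] V} (hK : Continuous K) (hK1 : ∀ s, ‖K s‖ ≤ 1) (y₀ w₀ : V) :
    ∃ y w : ℝ → V, y 0 = y₀ ∧ w 0 = w₀ ∧ SolvesSecondOrder t y w fun s => -K s (y s) := by
  have hlip : ∀ s, LipschitzWith 1 fun z : V × V => (z.2, -K s z.1) := by
    intro s
    refine LipschitzWith.of_dist_le_mul fun z z' => ?_
    rw [NNReal.coe_one, one_mul, dist_eq_norm, dist_eq_norm, Prod.mk_sub_mk, Prod.norm_mk,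
      Prod.norm_def, neg_sub_neg, ← map_sub, max_comm]
    refine max_le_max ?_ le_rfl
    rw [Prod.fst_sub, norm_sub_rev z.1]
    exact ((K s).le_of_opNorm_le (hK1 s) _).trans_eq (one_mul _)
  have hpl : IsPicardLindelof (fun s (z : V × V) => (z.2, -K s z.1))
      (⟨0, left_mem_Icc.2 ht0.le⟩ : Icc 0 t) (y₀, w₀) (‖(y₀, w₀)‖₊ + 1) 0
      (‖(y₀, w₀)‖₊ + (‖(y₀, w₀)‖₊ + 1)) 1 := by
    refine ⟨fun s _ => (hlip s).lipschitzOnWith, fun z _ => ?_, fun s _ z hz => ?_, ?_⟩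
    · exact Continuous.continuousOn (by fun_prop)
    · have h1 := (hlip s).dist_le_mul z 0
      have h2 : dist z (y₀, w₀) ≤ ‖(y₀, w₀)‖ + 1 := by simpa using hz
      have h3 : ‖z‖ ≤ dist z (y₀, w₀) + ‖(y₀, w₀)‖ := by
        rw [dist_eq_norm]
        simpa using norm_add_le (z - (y₀, w₀)) (y₀, w₀)
      simp only [NNReal.coe_one, one_mul, Prod.fst_zero, Prod.snd_zero, map_zero, neg_zero,
        Prod.mk_zero_zero, dist_zero_right] at h1
      push_cast [coe_nnnorm]
      linarith
    · push_cast [coe_nnnorm]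
      have := norm_nonneg (y₀, w₀)
      rw [sub_zero, sub_self, max_eq_left ht0.le, sub_zero]
      nlinarith
  obtain ⟨α, hα0, hα⟩ := hpl.exists_eq_forall_mem_Icc_hasDerivWithinAt₀
  refine ⟨fun s => (α s).1, fun s => (α s).2, by simp [hα0], by simp [hα0], fun s hs => ?_,
    fun s hs => ?_⟩
  · exact (ContinuousLinearMap.fst ℝ V V).hasFDerivAt.comp_hasDerivWithinAt s (hα s hs)
  · exact (ContinuousLinearMap.snd ℝ V V).hasFDerivAt.comp_hasDerivWithinAt s (hα s hs)

end SecondOrder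

section Frobenius

variable {d : ℕ}

/-- The columns of a linear map, as an element of an `ℓ²` space. -/
noncomputable def columnsCLM (d : ℕ) : (Ed d →L[ℝ] Ed d) →L[ℝ] PiLp 2 (fun _ : Fin d => Ed d) :=
  (PiLp.continuousLinearEquiv 2 ℝ (fun _ : Fin d => Ed d)).symm.toContinuousLinearMap ∘L
    ContinuousLinearMap.pi fun j => ContinuousLinearMap.apply ℝ (Ed d) (EuclideanSpace.single j 1)

lemma frobNorm_eq_sqrt_sum_norm (A : Ed d →L[ℝ] Ed d) :
    frobNorm A = √(∑ j, ‖A (EuclideanSpace.single j 1)‖ ^ 2) := by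
  simp only [frobNorm, EuclideanSpace.norm_sq_eq, Real.norm_eq_abs, sq_abs]
  rw [Finset.sum_comm]

lemma norm_columnsCLM (A : Ed d →L[ℝ] Ed d) : ‖columnsCLM d A‖ = frobNorm A := by
  rw [frobNorm_eq_sqrt_sum_norm, PiLp.norm_eq_of_L2]
  rfl

lemma frobNorm_nonneg (A : Ed d →L[ℝ] Ed d) : 0 ≤ frobNorm A := Real.sqrt_nonneg _

lemma frobNorm_sq (A : Ed d →L[ℝ] Ed d) :
    frobNorm A ^ 2 = ∑ j, ‖A (EuclideanSpace.single j 1)‖ ^ 2 := by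
  rw [frobNorm_eq_sqrt_sum_norm, Real.sq_sqrt (by positivity)]

lemma frobNorm_add_le (A B : Ed d →L[ℝ] Ed d) : frobNorm (A + B) ≤ frobNorm A + frobNorm B := by
  simpa only [← norm_columnsCLM, map_add] using norm_add_le (columnsCLM d A) (columnsCLM d B)

lemma frobNorm_comp_le_opNorm_mul (A B : Ed d →L[ℝ] Ed d) :
    frobNorm (A ∘L B) ≤ ‖A‖ * frobNorm B := by
  refine le_of_sq_le_sq ?_ (by have := frobNorm_nonneg B; positivity)
  rw [mul_pow, frobNorm_sq, frobNorm_sq, Finset.mul_sum]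
  refine Finset.sum_le_sum fun j _ => ?_
  rw [← mul_pow]
  gcongr
  exact A.le_opNorm _

lemma frobNorm_adjoint (A : Ed d →L[ℝ] Ed d) :
    frobNorm (ContinuousLinearMap.adjoint A) = frobNorm A := by
  have key : ∀ i j, ContinuousLinearMap.adjoint A (EuclideanSpace.single j 1) i =
      A (EuclideanSpace.single i 1) j := by
    intro i j
    have h := ContinuousLinearMap.adjoint_inner_right A (EuclideanSpace.single i (1 : ℝ))
      (EuclideanSpace.single j (1 : ℝ))
    simpa [EuclideanSpace.inner_single_left, EuclideanSpace.inner_single_right] using h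
  simp only [frobNorm, key]
  rw [Finset.sum_comm]

lemma frobNorm_comp_le_mul_opNorm (A B : Ed d →L[ℝ] Ed d) :
    frobNorm (A ∘L B) ≤ frobNorm A * ‖B‖ := by
  rw [← frobNorm_adjoint, ContinuousLinearMap.adjoint_comp, mul_comm, ← frobNorm_adjoint A,
    ← LinearIsometryEquiv.norm_map (ContinuousLinearMap.adjoint (𝕜 := ℝ)) B]
  exact frobNorm_comp_le_opNorm_mul _ _

lemma opNorm_le_frobNorm (A : Ed d →L[ℝ] Ed d) : ‖A‖ ≤ frobNorm A := by
  refine A.opNorm_le_bound (frobNorm_nonneg A) fun x => ?_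
  have hx : A x = ∑ j, x j • A (EuclideanSpace.single j 1) := by
    conv_lhs => rw [← (EuclideanSpace.basisFun (Fin d) ℝ).sum_repr x]
    simp
  rw [hx, frobNorm_eq_sqrt_sum_norm, EuclideanSpace.norm_eq x, mul_comm]
  refine (norm_sum_le Finset.univ fun j => x j • A (EuclideanSpace.single j 1)).trans ?_
  simp only [norm_smul]
  exact Real.sum_mul_le_sqrt_mul_sqrt _ _ _

lemma frobNorm_neg_comp_sub_le {H H' A A' : Ed d →L[ℝ] Ed d} (hH : ‖H‖ ≤ 1) :
    frobNorm (-(H ∘L A) - -(H' ∘L A')) ≤ frobNorm (A - A') + frobNorm (H - H') * ‖A'‖ := by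
  have h1 : -(H ∘L A) - -(H' ∘L A') = (-H) ∘L (A - A') + (H - H') ∘L (-A') := by
    ext x : 1
    simp
  rw [h1]
  refine (frobNorm_add_le _ _).trans (add_le_add ?_ ?_)
  · refine (frobNorm_comp_le_opNorm_mul _ _).trans ?_
    rw [norm_neg]
    exact mul_le_of_le_one_left (frobNorm_nonneg _) hH
  · simpa using frobNorm_comp_le_mul_opNorm (H - H') (-A')

lemma frobNormP_blockCLM_le (M₁₁ M₁₂ M₂₁ M₂₂ : Ed d →L[ℝ] Ed d) :
    frobNormP (blockCLM M₁₁ M₁₂ M₂₁ M₂₂) ≤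
      frobNorm M₁₁ + frobNorm M₁₂ + frobNorm M₂₁ + frobNorm M₂₂ := by
  have h : frobNormP (blockCLM M₁₁ M₁₂ M₂₁ M₂₂) =
      √((frobNorm M₁₁ ^ 2 + frobNorm M₂₁ ^ 2) + (frobNorm M₁₂ ^ 2 + frobNorm M₂₂ ^ 2)) := by
    simp only [frobNorm_sq, ← Finset.sum_add_distrib]
    simp [frobNormP, normSq, blockCLM, Finset.sum_add_distrib]
  have h11 := frobNorm_nonneg M₁₁
  have h12 := frobNorm_nonneg M₁₂
  have h21 := frobNorm_nonneg M₂₁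
  have h22 := frobNorm_nonneg M₂₂
  rw [h]
  refine Real.sqrt_le_iff.2 ⟨by positivity, ?_⟩
  have : 0 ≤ frobNorm M₁₁ * frobNorm M₁₂ + frobNorm M₁₁ * frobNorm M₂₁ +
    frobNorm M₁₁ * frobNorm M₂₂ + frobNorm M₁₂ * frobNorm M₂₁ +
    frobNorm M₁₂ * frobNorm M₂₂ + frobNorm M₂₁ * frobNorm M₂₂ := by positivity
  nlinarith

lemma blockCLM_sub (A B C D A' B' C' D' : Ed d →L[ℝ] Ed d) :
    blockCLM A B C D - blockCLM A' B' C' D' =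
      blockCLM (A - A') (B - B') (C - C') (D - D') := by
  refine ContinuousLinearMap.ext fun z => ?_
  simp only [blockCLM, sub_apply, ContinuousLinearMap.prod_apply,
    add_apply, ContinuousLinearMap.comp_apply, Prod.mk_sub_mk]
  congr 1 <;> abel

end Frobenius

section Jacobian

variable {d : ℕ} {t : ℝ}

/-- `A, B` and `W, Z` are the position and velocity components of the fundamental solution of
`y'' = -H y` on `[0, t]`. -/
structure IsFundamentalSolution (t : ℝ) (H A B W Z : ℝ → Ed d →L[ℝ] Ed d) : Prop where
  posX : SolvesSecondOrder t A W fun s => -(H s ∘L A s)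
  posV : SolvesSecondOrder t B Z fun s => -(H s ∘L B s)
  A_zero : A 0 = ContinuousLinearMap.id ℝ (Ed d)
  B_zero : B 0 = 0
  W_zero : W 0 = 0
  Z_zero : Z 0 = ContinuousLinearMap.id ℝ (Ed d)

lemma exists_isFundamentalSolution (ht0 : 0 < t) (ht : t ≤ 1 / 4) {H : ℝ → Ed d →L[ℝ] Ed d}
    (hH : Continuous H) (hH1 : ∀ s, ‖H s‖ ≤ 1) :
    ∃ A B W Z, IsFundamentalSolution t H A B W Z := by
  set K : ℝ → (Ed d →L[ℝ] Ed d) →L[ℝ] (Ed d →L[ℝ] Ed d) :=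
    fun s => ContinuousLinearMap.compL ℝ (Ed d) (Ed d) (Ed d) (H s)
  have hK : Continuous K := (ContinuousLinearMap.continuous _).comp hH
  have hK1 : ∀ s, ‖K s‖ ≤ 1 := fun s =>
    ((ContinuousLinearMap.compL ℝ (Ed d) (Ed d) (Ed d)).le_of_opNorm_le
      (ContinuousLinearMap.norm_compL_le ℝ (Ed d) (Ed d) (Ed d)) (H s)).trans (by simpa using hH1 s)
  obtain ⟨A, W, hA0, hW0, hAW⟩ :=
    exists_solvesSecondOrder_linear ht0 ht hK hK1 (ContinuousLinearMap.id ℝ (Ed d)) 0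
  obtain ⟨B, Z, hB0, hZ0, hBZ⟩ :=
    exists_solvesSecondOrder_linear ht0 ht hK hK1 0 (ContinuousLinearMap.id ℝ (Ed d))
  exact ⟨A, B, W, Z, hAW, hBZ, hA0, hB0, hW0, hZ0⟩

namespace IsFundamentalSolution

variable {H A B W Z H' A' B' W' Z' : ℝ → Ed d →L[ℝ] Ed d}

lemma norm_A_le (h : IsFundamentalSolution t H A B W Z) (ht : t ≤ 1 / 4) (hH : ∀ s, ‖H s‖ ≤ 1)
    {s : ℝ} (hs : s ∈ Icc 0 t) : ‖A s‖ ≤ 1 + 16 / 31 * s ^ 2 ∧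
      ‖A s - ContinuousLinearMap.id ℝ (Ed d)‖ ≤ 16 / 31 * s ^ 2 := by
  have key := h.posX.norm_le_and_norm_sub_sub_le ht (fun r _ => by
    rw [norm_neg]
    exact ((H r).opNorm_comp_le (A r)).trans (mul_le_of_le_one_left (norm_nonneg _) (hH r))) s hs
  have hid := ContinuousLinearMap.norm_id_le (𝕜 := ℝ) (E := Ed d)
  rw [h.A_zero, h.W_zero, norm_zero, zero_mul, add_zero, smul_zero, sub_zero] at key
  exact ⟨key.1.trans (mul_le_of_le_one_right (by positivity) hid),
    key.2.trans (mul_le_of_le_one_right (by positivity) hid)⟩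

lemma norm_B_le (h : IsFundamentalSolution t H A B W Z) (ht : t ≤ 1 / 4) (hH : ∀ s, ‖H s‖ ≤ 1)
    {s : ℝ} (hs : s ∈ Icc 0 t) : ‖B s‖ ≤ (1 + 16 / 31 * s ^ 2) * s ∧
      ‖B s - s • ContinuousLinearMap.id ℝ (Ed d)‖ ≤ 16 / 31 * s ^ 2 * s := by
  have key := h.posV.norm_le_and_norm_sub_sub_le ht (fun r _ => by
    rw [norm_neg]
    exact ((H r).opNorm_comp_le (B r)).trans (mul_le_of_le_one_left (norm_nonneg _) (hH r))) s hs
  have hid := mul_le_of_le_one_left hs.1 (ContinuousLinearMap.norm_id_le (𝕜 := ℝ) (E := Ed d))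
  rw [h.B_zero, h.Z_zero, norm_zero, zero_add, sub_zero] at key
  exact ⟨key.1.trans (by gcongr), key.2.trans (by gcongr)⟩

/-- The part of the position-column beyond first order in `H`. -/
lemma remainderX (h : IsFundamentalSolution t H A B W Z) (hH : Continuous H) :
    SolvesSecondOrder t
      (fun s => A s - (ContinuousLinearMap.id ℝ (Ed d) - ∫ r in (0 : ℝ)..s, (s - r) • H r))
      (fun s => W s - -∫ r in (0 : ℝ)..s, H r)
      (fun s => -(H s ∘L (A s - ContinuousLinearMap.id ℝ (Ed d)))) := by
  have hint : (fun s => ∫ r in (0 : ℝ)..s, (s - r) • H r) =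
      fun s => s • (∫ r in (0 : ℝ)..s, H r) - ∫ r in (0 : ℝ)..s, r • H r := by
    funext s
    rw [← intervalIntegral.integral_smul, ← intervalIntegral.integral_sub]
    · exact intervalIntegral.integral_congr fun r _ => sub_smul s r (H r)
    · exact (by fun_prop : Continuous fun r => s • H r).intervalIntegrable _ _
    · exact (by fun_prop : Continuous fun r => r • H r).intervalIntegrable _ _
  have hd1 : ∀ s, HasDerivAt (fun s => ∫ r in (0 : ℝ)..s, H r) (H s) s := fun s =>
    (hH.integral_hasStrictDerivAt 0 s).hasDerivAt
  have hd2 : ∀ s, HasDerivAt (fun s => ∫ r in (0 : ℝ)..s, (s - r) • H r)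
      (∫ r in (0 : ℝ)..s, H r) s := by
    intro s
    rw [hint]
    have h2 : HasDerivAt (fun s => ∫ r in (0 : ℝ)..s, r • H r) (s • H s) s :=
      ((by fun_prop : Continuous fun r => r • H r).integral_hasStrictDerivAt 0 s).hasDerivAt
    refine (((hasDerivAt_id s).smul (hd1 s)).sub h2).congr_deriv ?_
    simp
  refine ⟨fun s hs => ?_, fun s hs => ?_⟩
  · refine ((h.posX.pos s hs).sub
      ((hasDerivWithinAt_const s (Icc 0 t) (ContinuousLinearMap.id ℝ (Ed d))).sub
        (hd2 s).hasDerivWithinAt)).congr_deriv ?_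
    simp
  · refine ((h.posX.vel s hs).sub (hd1 s).hasDerivWithinAt.neg).congr_deriv ?_
    rw [ContinuousLinearMap.comp_sub, ContinuousLinearMap.comp_id]
    abel

/-- The part of the velocity-column beyond first order in `H`. -/
lemma remainderV (h : IsFundamentalSolution t H A B W Z) (hH : Continuous H) :
    ∀ s ∈ Icc 0 t, HasDerivWithinAt
      (fun s => Z s - (ContinuousLinearMap.id ℝ (Ed d) - ∫ r in (0 : ℝ)..s, r • H r))
      (-(H s ∘L (B s - s • ContinuousLinearMap.id ℝ (Ed d)))) (Icc 0 t) s := by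
  intro s hs
  have h2 : HasDerivAt (fun s => ∫ r in (0 : ℝ)..s, r • H r) (s • H s) s :=
    ((by fun_prop : Continuous fun r => r • H r).integral_hasStrictDerivAt 0 s).hasDerivAt
  refine ((h.posV.vel s hs).sub
    ((hasDerivWithinAt_const s (Icc 0 t) (ContinuousLinearMap.id ℝ (Ed d))).sub
      h2.hasDerivWithinAt)).congr_deriv ?_
  rw [ContinuousLinearMap.comp_sub, ContinuousLinearMap.comp_smul, ContinuousLinearMap.comp_id]
  abel

end IsFundamentalSolution

variable {D D₁ D₂ : ℝ → Ed d →L[ℝ] Ed d} {p q r u : ℝ}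

lemma frobNorm_le_of_frobNorm_derivWithin_le_cubic
    (hD : ∀ s ∈ Icc 0 t, HasDerivWithinAt D (D₁ s) (Icc 0 t) s) (hD0 : D 0 = 0)
    (hb : ∀ s ∈ Icc 0 t, frobNorm (D₁ s) ≤ p + q * s + r * s ^ 2 + u * s ^ 3)
    {τ : ℝ} (hτ : τ ∈ Icc 0 t) :
    frobNorm (D τ) ≤ p * τ + q * τ ^ 2 / 2 + r * τ ^ 3 / 3 + u * τ ^ 4 / 4 := by
  have := norm_sub_le_of_norm_derivWithin_le_cubic (y := fun s => columnsCLM d (D s))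
    (w := fun s => columnsCLM d (D₁ s)) (p := p) (q := q) (r := r) (u := u)
    (fun s hs => (columnsCLM d).hasFDerivAt.comp_hasDerivWithinAt s (hD s hs)) hτ
    (fun s hs => by rw [norm_columnsCLM]; exact hb s ⟨hs.1, hs.2.trans hτ.2⟩)
  rwa [hD0, map_zero, sub_zero, norm_columnsCLM] at this

lemma SolvesSecondOrder.frobNorm_le_cubic (h : SolvesSecondOrder t D D₁ D₂)
    (hD0 : D 0 = 0) (hD₁0 : D₁ 0 = 0)
    (hb : ∀ s ∈ Icc 0 t, frobNorm (D₂ s) ≤ p + q * s + r * s ^ 2 + u * s ^ 3)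
    {τ : ℝ} (hτ : τ ∈ Icc 0 t) :
    frobNorm (D τ) ≤ p * τ ^ 2 / 2 + q * τ ^ 3 / 6 + r * τ ^ 4 / 12 + u * τ ^ 5 / 20 := by
  have := (h.map (columnsCLM d)).norm_sub_sub_le_cubic hτ (p := p) (q := q) (r := r) (u := u)
    (fun s hs => by rw [norm_columnsCLM]; exact hb s ⟨hs.1, hs.2.trans hτ.2⟩)
  rwa [hD0, hD₁0, map_zero, sub_zero, smul_zero, sub_zero, norm_columnsCLM] at this

lemma SolvesSecondOrder.frobNorm_le (h : SolvesSecondOrder t D D₁ D₂) (ht : t ≤ 1 / 4)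
    (hp : 0 ≤ p) (hq : 0 ≤ q) (hr : 0 ≤ r) (hu : 0 ≤ u) (hD0 : D 0 = 0) (hD₁0 : D₁ 0 = 0)
    (hb : ∀ s ∈ Icc 0 t,
      frobNorm (D₂ s) ≤ frobNorm (D s) + (p + q * s + r * s ^ 2 + u * s ^ 3))
    {τ : ℝ} (hτ : τ ∈ Icc 0 t) :
    frobNorm (D τ) ≤
      32 / 31 * (p * τ ^ 2 / 2 + q * τ ^ 3 / 6 + r * τ ^ 4 / 12 + u * τ ^ 5 / 20) := by
  have := (h.map (columnsCLM d)).norm_le ht hp hq hr hu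
    (fun s hs => by rw [norm_columnsCLM, norm_columnsCLM]; exact hb s hs) τ hτ
  rwa [hD0, hD₁0, map_zero, norm_zero, zero_mul, zero_add, zero_add, norm_columnsCLM] at this

namespace IsFundamentalSolution

variable {H A B W Z H' A' B' W' Z' : ℝ → Ed d →L[ℝ] Ed d}

/-- Stability in Frobenius norm of the fundamental solution of `y'' = -H y` with respect to `H`. -/
theorem frobNorm_sub_le (h : IsFundamentalSolution t H A B W Z)
    (h' : IsFundamentalSolution t H' A' B' W' Z') (ht0 : 0 < t) (ht : t ≤ 1 / 4)
    (hH : ∀ s, ‖H s‖ ≤ 1) (hH' : ∀ s, ‖H' s‖ ≤ 1) (hp : 0 ≤ p) (hq : 0 ≤ q)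
    (hHH' : ∀ s ∈ Icc 0 t, frobNorm (H s - H' s) ≤ (1 + 16 / 31 * s ^ 2) * (p + q * s)) :
    (∀ s ∈ Icc 0 t, frobNorm (A s - A' s) ≤ 551 / 1000 * p * s ^ 2 + 551 / 3000 * q * s ^ 3) ∧
    (∀ s ∈ Icc 0 t, frobNorm (B s - B' s) ≤ 551 / 3000 * p * s ^ 3 + 551 / 6000 * q * s ^ 4) ∧
    frobNorm (W t - W' t) ≤ 21 / 20 * t * p + 21 / 40 * t ^ 2 * q ∧
    frobNorm (Z t - Z' t) ≤ 21 / 40 * t ^ 2 * p + 11 / 30 * t ^ 3 * q := by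
  have hsq : ∀ s ∈ Icc 0 t, s ^ 2 ≤ 1 / 16 := fun s hs => by nlinarith [hs.1, hs.2]
  have hsrc : ∀ s ∈ Icc 0 t, (1 + 16 / 31 * s ^ 2) * (1 + 16 / 31 * s ^ 2) ≤
      1 + 21 / 20 * s ^ 2 := fun s hs => by nlinarith [hsq s hs, sq_nonneg s]
  have hpq : ∀ s ∈ Icc 0 t, 0 ≤ p + q * s := fun s hs => add_nonneg hp (mul_nonneg hq hs.1)
  have hA : ∀ s ∈ Icc 0 t, frobNorm (H s - H' s) * ‖A' s‖ ≤
      (1 + 21 / 20 * s ^ 2) * (p + q * s) := by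
    intro s hs
    have h0 := hpq s hs
    calc frobNorm (H s - H' s) * ‖A' s‖
        ≤ ((1 + 16 / 31 * s ^ 2) * (p + q * s)) * (1 + 16 / 31 * s ^ 2) :=
          mul_le_mul (hHH' s hs) (h'.norm_A_le ht hH' hs).1 (norm_nonneg _) (by positivity)
      _ = ((1 + 16 / 31 * s ^ 2) * (1 + 16 / 31 * s ^ 2)) * (p + q * s) := by ring
      _ ≤ _ := mul_le_mul_of_nonneg_right (hsrc s hs) h0
  have hB : ∀ s ∈ Icc 0 t, frobNorm (H s - H' s) * ‖B' s‖ ≤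
      (1 + 21 / 20 * s ^ 2) * (p * s + q * s ^ 2) := by
    intro s hs
    have h0 := hpq s hs
    calc frobNorm (H s - H' s) * ‖B' s‖
        ≤ ((1 + 16 / 31 * s ^ 2) * (p + q * s)) * ((1 + 16 / 31 * s ^ 2) * s) :=
          mul_le_mul (hHH' s hs) (h'.norm_B_le ht hH' hs).1 (norm_nonneg _) (by positivity)
      _ = ((1 + 16 / 31 * s ^ 2) * (1 + 16 / 31 * s ^ 2)) * ((p + q * s) * s) := by ring
      _ ≤ (1 + 21 / 20 * s ^ 2) * ((p + q * s) * s) :=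
          mul_le_mul_of_nonneg_right (hsrc s hs) (mul_nonneg h0 hs.1)
      _ = _ := by ring
  have hcrude : ∀ s ∈ Icc 0 t, 1 + 21 / 20 * s ^ 2 ≤ (16 / 15 : ℝ) := fun s hs => by
    linarith [hsq s hs]
  have hDA : ∀ s ∈ Icc 0 t,
      frobNorm (A s - A' s) ≤ 551 / 1000 * p * s ^ 2 + 551 / 3000 * q * s ^ 3 := by
    intro s hs
    refine ((h.posX.sub h'.posX).frobNorm_le (p := 16 / 15 * p) (q := 16 / 15 * q) (r := 0)
      (u := 0) ht (by positivity) (by positivity) le_rfl le_rfl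
      (by rw [h.A_zero, h'.A_zero, sub_self]) (by rw [h.W_zero, h'.W_zero, sub_self])
      (fun τ hτ => ?_) hs).trans ?_
    · refine (frobNorm_neg_comp_sub_le (hH τ)).trans (add_le_add_right ?_ _)
      refine (hA τ hτ).trans ((mul_le_mul_of_nonneg_right (hcrude τ hτ) (hpq τ hτ)).trans ?_)
      linarith
    · have h1 : 0 ≤ p * s ^ 2 := by positivity
      have h2 : 0 ≤ q * s ^ 3 := mul_nonneg hq (pow_nonneg hs.1 3)
      linarith
  have hDB : ∀ s ∈ Icc 0 t,
      frobNorm (B s - B' s) ≤ 551 / 3000 * p * s ^ 3 + 551 / 6000 * q * s ^ 4 := by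
    intro s hs
    refine ((h.posV.sub h'.posV).frobNorm_le (p := 0) (q := 16 / 15 * p) (r := 16 / 15 * q)
      (u := 0) ht le_rfl (by positivity) (by positivity) le_rfl
      (by rw [h.B_zero, h'.B_zero, sub_self]) (by rw [h.Z_zero, h'.Z_zero, sub_self])
      (fun τ hτ => ?_) hs).trans ?_
    · refine (frobNorm_neg_comp_sub_le (hH τ)).trans (add_le_add_right ?_ _)
      refine (hB τ hτ).trans ((mul_le_mul_of_nonneg_right (hcrude τ hτ) ?_).trans ?_)
      · have := hτ.1
        positivity
      · linarith
    · have h1 : 0 ≤ p * s ^ 3 := mul_nonneg hp (pow_nonneg hs.1 3)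
      have h2 : 0 ≤ q * s ^ 4 := by positivity
      linarith
  have htt := right_mem_Icc.2 ht0.le
  have ht3 : t ^ 3 ≤ t / 16 := by nlinarith [hsq t htt]
  have ht4 : t ^ 4 ≤ t ^ 2 / 16 := by nlinarith [hsq t htt, sq_nonneg t]
  refine ⟨hDA, hDB, ?_, ?_⟩
  · refine (frobNorm_le_of_frobNorm_derivWithin_le_cubic (h.posX.sub h'.posX).vel (p := p)
      (q := q) (r := 1601 / 1000 * p) (u := (21 / 20 + 551 / 3000) * q)
      (by rw [h.W_zero, h'.W_zero, sub_self]) (fun s hs => ?_) htt).trans ?_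
    · refine (frobNorm_neg_comp_sub_le (hH s)).trans ?_
      linarith [hA s hs, hDA s hs]
    · have h1 := mul_le_mul_of_nonneg_left ht3 hp
      have h2 := mul_le_mul_of_nonneg_left ht4 hq
      have h3 : 0 ≤ p * t := by positivity
      have h4 : 0 ≤ q * t ^ 2 := by positivity
      linarith
  · refine (frobNorm_le_of_frobNorm_derivWithin_le_cubic (h.posV.sub h'.posV).vel (p := 0)
      (q := p) (r := q) (u := (21 / 20 + 551 / 3000) * p + 3 / 10 * q)
      (by rw [h.Z_zero, h'.Z_zero, sub_self]) (fun s hs => ?_) htt).trans ?_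
    · refine (frobNorm_neg_comp_sub_le (hH s)).trans ?_
      have h1 : q * s ^ 4 ≤ q * s ^ 3 * (1 / 4) := by
        have : 0 ≤ q * s ^ 3 := mul_nonneg hq (pow_nonneg hs.1 3)
        have := mul_le_mul_of_nonneg_left (hs.2.trans ht) this
        linarith
      have h2 : 0 ≤ q * s ^ 3 := mul_nonneg hq (pow_nonneg hs.1 3)
      linarith [hB s hs, hDB s hs]
    · have h1 := mul_le_mul_of_nonneg_left ht4 hp
      have h2 : q * t ^ 4 ≤ q * t ^ 3 * (1 / 4) := by
        have : 0 ≤ q * t ^ 3 := by positivity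
        have := mul_le_mul_of_nonneg_left ht this
        linarith
      have h3 : 0 ≤ p * t ^ 2 := by positivity
      have h4 : 0 ≤ q * t ^ 3 := by positivity
      linarith

/-- Stability in Frobenius norm of the part of the fundamental solution of `y'' = -H y` beyond
first order in `H`. -/
theorem frobNorm_remainder_sub_le (h : IsFundamentalSolution t H A B W Z)
    (h' : IsFundamentalSolution t H' A' B' W' Z') (ht0 : 0 < t) (ht : t ≤ 1 / 4)
    (hHc : Continuous H) (hHc' : Continuous H')
    (hH : ∀ s, ‖H s‖ ≤ 1) (hH' : ∀ s, ‖H' s‖ ≤ 1) (hp : 0 ≤ p) (hq : 0 ≤ q)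
    (hHH' : ∀ s ∈ Icc 0 t, frobNorm (H s - H' s) ≤ (1 + 16 / 31 * s ^ 2) * (p + q * s)) :
    frobNorm (A t - (ContinuousLinearMap.id ℝ (Ed d) - ∫ s in (0 : ℝ)..t, (t - s) • H s) -
        (A' t - (ContinuousLinearMap.id ℝ (Ed d) - ∫ s in (0 : ℝ)..t, (t - s) • H' s))) +
      frobNorm (B t - t • ContinuousLinearMap.id ℝ (Ed d) -
        (B' t - t • ContinuousLinearMap.id ℝ (Ed d))) +
      frobNorm (W t - (-∫ s in (0 : ℝ)..t, H s) - (W' t - (-∫ s in (0 : ℝ)..t, H' s))) +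
      frobNorm (Z t - (ContinuousLinearMap.id ℝ (Ed d) - ∫ s in (0 : ℝ)..t, s • H s) -
        (Z' t - (ContinuousLinearMap.id ℝ (Ed d) - ∫ s in (0 : ℝ)..t, s • H' s))) ≤
      7 / 20 * t ^ 3 * (2 * p + t * q) := by
  obtain ⟨hDA, hDB, -, -⟩ := h.frobNorm_sub_le h' ht0 ht hH hH' hp hq hHH'
  have hG : ∀ s ∈ Icc 0 t, frobNorm (H s - H' s) ≤ 32 / 31 * (p + q * s) := by
    intro s hs
    refine (hHH' s hs).trans ?_
    have h0 : 0 ≤ p + q * s := add_nonneg hp (mul_nonneg hq hs.1)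
    have h1 : s ^ 2 ≤ 1 / 16 := by nlinarith [hs.1, hs.2]
    gcongr
    linarith
  have hX : ∀ s ∈ Icc 0 t,
      frobNorm (-(H s ∘L (A s - ContinuousLinearMap.id ℝ (Ed d))) -
        -(H' s ∘L (A' s - ContinuousLinearMap.id ℝ (Ed d)))) ≤
      0 + 0 * s + 1084 / 1000 * p * s ^ 2 + 717 / 1000 * q * s ^ 3 := by
    intro s hs
    refine (frobNorm_neg_comp_sub_le (hH s)).trans ?_
    rw [sub_sub_sub_cancel_right]
    have h0 : 0 ≤ p + q * s := add_nonneg hp (mul_nonneg hq hs.1)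
    have h1 := mul_le_mul (hG s hs) (h'.norm_A_le ht hH' hs).2 (norm_nonneg _) (by positivity)
    have h2 : 0 ≤ p * s ^ 2 := by positivity
    have h3 : 0 ≤ q * s ^ 3 := mul_nonneg hq (pow_nonneg hs.1 3)
    linarith [hDA s hs]
  have hV : ∀ s ∈ Icc 0 t,
      frobNorm (-(H s ∘L (B s - s • ContinuousLinearMap.id ℝ (Ed d))) -
        -(H' s ∘L (B' s - s • ContinuousLinearMap.id ℝ (Ed d)))) ≤
      0 + 0 * s + 0 * s ^ 2 + (717 / 1000 * p + 4 / 25 * q) * s ^ 3 := by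
    intro s hs
    refine (frobNorm_neg_comp_sub_le (hH s)).trans ?_
    rw [sub_sub_sub_cancel_right]
    have h0 : 0 ≤ p + q * s := add_nonneg hp (mul_nonneg hq hs.1)
    have h1 := mul_le_mul (hG s hs) (h'.norm_B_le ht hH' hs).2 (norm_nonneg _) (by positivity)
    have h2 : 0 ≤ p * s ^ 3 := mul_nonneg hp (pow_nonneg hs.1 3)
    have h3 : 0 ≤ q * s ^ 3 := mul_nonneg hq (pow_nonneg hs.1 3)
    have h4 := mul_le_mul_of_nonneg_left (hs.2.trans ht) h3
    linarith [hDB s hs]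
  have htt := right_mem_Icc.2 ht0.le
  have hRX := (h.remainderX hHc).sub (h'.remainderX hHc')
  have h11 := hRX.frobNorm_le_cubic (by simp [h.A_zero, h'.A_zero])
    (by simp [h.W_zero, h'.W_zero]) hX htt
  have h21 := frobNorm_le_of_frobNorm_derivWithin_le_cubic hRX.vel
    (by simp [h.W_zero, h'.W_zero]) hX htt
  have h22 := frobNorm_le_of_frobNorm_derivWithin_le_cubic
    (fun s hs => (h.remainderV hHc s hs).sub (h'.remainderV hHc' s hs))
    (by simp [h.Z_zero, h'.Z_zero]) hV htt
  have h12 := hDB t htt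
  rw [← sub_sub_sub_cancel_right _ _ (t • ContinuousLinearMap.id ℝ (Ed d))] at h12
  have h1 := mul_le_mul_of_nonneg_left ht (by positivity : 0 ≤ p * t ^ 3)
  have h2 := mul_le_mul_of_nonneg_left ht (by positivity : 0 ≤ q * t ^ 4)
  have h3 : 0 ≤ p * t ^ 3 := by positivity
  have h4 : 0 ≤ q * t ^ 4 := by positivity
  simp only [Pi.sub_apply] at h22
  linarith

end IsFundamentalSolution

end Jacobian

section Flow

variable {d : ℕ} {U : Ed d → ℝ} {Φ : ℝ → Phase d → Phase d} {t : ℝ}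

lemma ContDiff.gradient (hU : ContDiff ℝ 2 U) : ContDiff ℝ 1 (gradient U) :=
  (InnerProductSpace.toDual ℝ (Ed d)).symm.contDiff.comp (hU.fderiv_right (by norm_num))

lemma solvesSecondOrder_flow
    (hΦ : ∀ z s, HasDerivAt (fun u => Φ u z) ((Φ s z).2, -gradient U (Φ s z).1) s) (z : Phase d) :
    SolvesSecondOrder t (fun s => (Φ s z).1) (fun s => (Φ s z).2)
      (fun s => -gradient U (Φ s z).1) :=
  ⟨fun s _ => ((ContinuousLinearMap.fst ℝ (Ed d) (Ed d)).hasFDerivAt.comp_hasDerivAt s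
      (hΦ z s)).hasDerivWithinAt,
    fun s _ => ((ContinuousLinearMap.snd ℝ (Ed d) (Ed d)).hasFDerivAt.comp_hasDerivAt s
      (hΦ z s)).hasDerivWithinAt⟩

lemma norm_gradient_sub_le (hU : ContDiff ℝ 2 U) (hHess : ∀ x, ‖fderiv ℝ (gradient U) x‖ ≤ 1)
    (x y : Ed d) : ‖gradient U x - gradient U y‖ ≤ ‖x - y‖ := by
  simpa using convex_univ.norm_image_sub_le_of_norm_fderiv_le (𝕜 := ℝ) (C := 1)
    (fun a _ => hU.gradient.differentiable one_ne_zero a) (fun a _ => hHess a)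
    (mem_univ y) (mem_univ x)

/-- A first-order Taylor estimate for the gradient of a function with Lipschitz Hessian. -/
lemma norm_gradient_sub_sub_le (hU : ContDiff ℝ 2 U) {LH : ℝ} (hLH : 0 ≤ LH)
    (hHessLip : ∀ x x' : Ed d,
      frobNorm (fderiv ℝ (gradient U) x - fderiv ℝ (gradient U) x') ≤ LH * ‖x - x'‖)
    (x y : Ed d) :
    ‖gradient U y - gradient U x - fderiv ℝ (gradient U) x (y - x)‖ ≤ LH * ‖y - x‖ ^ 2 := by
  have := (convex_closedBall x ‖y - x‖).norm_image_sub_le_of_norm_fderiv_le' (𝕜 := ℝ)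
    (f := gradient U) (φ := fderiv ℝ (gradient U) x) (C := LH * ‖y - x‖)
    (fun a _ => hU.gradient.differentiable one_ne_zero a)
    (fun a ha => (opNorm_le_frobNorm _).trans ((hHessLip a x).trans (by
      rw [mem_closedBall_iff_norm] at ha
      gcongr)))
    (Metric.mem_closedBall_self (norm_nonneg _)) (mem_closedBall_iff_norm.2 le_rfl)
  rwa [mul_assoc, ← sq] at this

lemma continuous_fderiv_gradient_flow (hU : ContDiff ℝ 2 U)
    (hΦ : ∀ z s, HasDerivAt (fun u => Φ u z) ((Φ s z).2, -gradient U (Φ s z).1) s) (z : Phase d) :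
    Continuous fun s => fderiv ℝ (gradient U) (Φ s z).1 :=
  (hU.gradient.continuous_fderiv one_ne_zero).comp
    (continuous_fst.comp (continuous_iff_continuousAt.2 fun s => (hΦ z s).continuousAt))

lemma norm_flow_sub_le (hU : ContDiff ℝ 2 U) (hHess : ∀ x, ‖fderiv ℝ (gradient U) x‖ ≤ 1)
    (ht : t ≤ 1 / 4) (hΦ0 : ∀ z, Φ 0 z = z)
    (hΦ : ∀ z s, HasDerivAt (fun u => Φ u z) ((Φ s z).2, -gradient U (Φ s z).1) s)
    (z z' : Phase d) {s : ℝ} (hs : s ∈ Icc 0 t) :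
    ‖(Φ s z).1 - (Φ s z').1‖ ≤ (1 + 16 / 31 * s ^ 2) * (‖z.1 - z'.1‖ + ‖z.2 - z'.2‖ * s) := by
  have key := (((solvesSecondOrder_flow hΦ z).sub
    (solvesSecondOrder_flow hΦ z')).norm_le_and_norm_sub_sub_le ht (fun r _ => by
      rw [neg_sub_neg, norm_sub_rev]
      exact norm_gradient_sub_le hU hHess _ _) s hs).1
  simpa only [hΦ0] using key

/-- The derivative of the flow is given by the fundamental solution of the linearised equation. -/
theorem hasFDerivAt_flow (hU : ContDiff ℝ 2 U) (hHess : ∀ x, ‖fderiv ℝ (gradient U) x‖ ≤ 1)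
    {LH : ℝ} (hLH : 0 ≤ LH) (hHessLip : ∀ x x' : Ed d,
      frobNorm (fderiv ℝ (gradient U) x - fderiv ℝ (gradient U) x') ≤ LH * ‖x - x'‖)
    (ht0 : 0 < t) (ht : t ≤ 1 / 4) (hΦ0 : ∀ z, Φ 0 z = z)
    (hΦ : ∀ z s, HasDerivAt (fun u => Φ u z) ((Φ s z).2, -gradient U (Φ s z).1) s)
    (z : Phase d) {A B W Z : ℝ → Ed d →L[ℝ] Ed d}
    (hf : IsFundamentalSolution t (fun s => fderiv ℝ (gradient U) (Φ s z).1) A B W Z) :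
    HasFDerivAt (Φ t) (blockCLM (A t) (B t) (W t) (Z t)) z := by
  have hbound : ∀ z' : Phase d, ‖Φ t z' - Φ t z - blockCLM (A t) (B t) (W t) (Z t) (z' - z)‖ ≤
      2 * LH * ‖z' - z‖ ^ 2 := by
    intro z'
    have hC : 0 ≤ 2 * LH * ‖z' - z‖ ^ 2 := by positivity
    have hsol := (((solvesSecondOrder_flow (t := t) hΦ z').sub (solvesSecondOrder_flow hΦ z)).sub
      (hf.posX.map (ContinuousLinearMap.apply ℝ (Ed d) (z' - z).1))).sub
        (hf.posV.map (ContinuousLinearMap.apply ℝ (Ed d) (z' - z).2))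
    simp only [ContinuousLinearMap.apply_apply] at hsol
    have hdist : ∀ s ∈ Icc 0 t, LH * ‖(Φ s z').1 - (Φ s z).1‖ ^ 2 ≤ 2 * LH * ‖z' - z‖ ^ 2 := by
      intro s hs
      have h1 : ‖(Φ s z').1 - (Φ s z).1‖ ≤ 7 / 5 * ‖z' - z‖ := by
        refine (norm_flow_sub_le hU hHess ht hΦ0 hΦ z' z hs).trans ?_
        have hx : ‖z'.1 - z.1‖ ≤ ‖z' - z‖ := norm_fst_le (z' - z)
        have hv : ‖z'.2 - z.2‖ ≤ ‖z' - z‖ := norm_snd_le (z' - z)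
        have hs2 : s ^ 2 ≤ 1 / 16 := by nlinarith [hs.1, hs.2]
        have hs4 := hs.2.trans ht
        have := hs.1
        calc (1 + 16 / 31 * s ^ 2) * (‖z'.1 - z.1‖ + ‖z'.2 - z.2‖ * s)
            ≤ (1 + 16 / 31 * (1 / 16)) * (‖z' - z‖ + ‖z' - z‖ * (1 / 4)) := by gcongr
          _ ≤ _ := by linarith [norm_nonneg (z' - z)]
      have h2 : ‖(Φ s z').1 - (Φ s z).1‖ ^ 2 ≤ 2 * ‖z' - z‖ ^ 2 := by
        nlinarith [norm_nonneg ((Φ s z').1 - (Φ s z).1), norm_nonneg (z' - z)]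
      calc LH * ‖(Φ s z').1 - (Φ s z).1‖ ^ 2 ≤ LH * (2 * ‖z' - z‖ ^ 2) := by gcongr
        _ = _ := by ring
    have hF : ∀ s ∈ Icc 0 t, ‖-gradient U (Φ s z').1 - -gradient U (Φ s z).1 -
        (-(fderiv ℝ (gradient U) (Φ s z).1 ∘L A s)) (z' - z).1 -
        (-(fderiv ℝ (gradient U) (Φ s z).1 ∘L B s)) (z' - z).2‖ ≤
        ‖(Φ s z').1 - (Φ s z).1 - A s (z' - z).1 - B s (z' - z).2‖ +
          2 * LH * ‖z' - z‖ ^ 2 := by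
      intro s hs
      have hsplit : -gradient U (Φ s z').1 - -gradient U (Φ s z).1 -
          (-(fderiv ℝ (gradient U) (Φ s z).1 ∘L A s)) (z' - z).1 -
          (-(fderiv ℝ (gradient U) (Φ s z).1 ∘L B s)) (z' - z).2 =
          -(fderiv ℝ (gradient U) (Φ s z).1
            ((Φ s z').1 - (Φ s z).1 - A s (z' - z).1 - B s (z' - z).2)) -
          (gradient U (Φ s z').1 - gradient U (Φ s z).1 -
            fderiv ℝ (gradient U) (Φ s z).1 ((Φ s z').1 - (Φ s z).1)) := by
        simp only [map_sub, neg_apply, ContinuousLinearMap.comp_apply]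
        abel
      rw [hsplit]
      refine (norm_sub_le _ _).trans (add_le_add ?_ ?_)
      · rw [norm_neg]
        exact (ContinuousLinearMap.le_of_opNorm_le _ (hHess _) _).trans_eq (one_mul _)
      · exact (norm_gradient_sub_sub_le hU hLH hHessLip _ _).trans (hdist s hs)
    have hpos0 : (Φ 0 z').1 - (Φ 0 z).1 - A 0 (z' - z).1 - B 0 (z' - z).2 = 0 := by
      simp [hΦ0, hf.A_zero, hf.B_zero]
    have hvel0 : (Φ 0 z').2 - (Φ 0 z).2 - W 0 (z' - z).1 - Z 0 (z' - z).2 = 0 := by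
      simp [hΦ0, hf.W_zero, hf.Z_zero]
    have hpos : ∀ s ∈ Icc 0 t, ‖(Φ s z').1 - (Φ s z).1 - A s (z' - z).1 - B s (z' - z).2‖ ≤
        2 * LH * ‖z' - z‖ ^ 2 := by
      intro s hs
      have key := hsol.norm_le (p := 2 * LH * ‖z' - z‖ ^ 2) (q := 0) (r := 0) (u := 0) ht hC
        le_rfl le_rfl le_rfl (fun τ hτ => (hF τ hτ).trans_eq (by ring)) s hs
      rw [hpos0, hvel0, norm_zero] at key
      have hs2 : s ^ 2 ≤ 1 / 16 := by nlinarith [hs.1, hs.2]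
      linarith [mul_le_mul_of_nonneg_left hs2 hC]
    have htt := right_mem_Icc.2 ht0.le
    have hvel : ‖(Φ t z').2 - (Φ t z).2 - W t (z' - z).1 - Z t (z' - z).2‖ ≤
        2 * LH * ‖z' - z‖ ^ 2 := by
      have key := norm_sub_le_of_norm_derivWithin_le_cubic
        (p := 2 * (2 * LH * ‖z' - z‖ ^ 2)) (q := 0) (r := 0) (u := 0) hsol.vel htt
        (fun s hs => (hF s hs).trans (by linarith [hpos s hs]))
      rw [hvel0, sub_zero] at key
      linarith [mul_le_mul_of_nonneg_left ht hC]
    refine norm_prod_le_iff.2 ⟨?_, ?_⟩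
    · refine le_of_eq_of_le (congrArg norm ?_) (hpos t htt)
      simp only [blockCLM, Prod.fst_sub]
      simp [sub_sub, add_assoc]
    · refine le_of_eq_of_le (congrArg norm ?_) hvel
      simp only [blockCLM, Prod.snd_sub]
      simp [sub_sub, add_assoc]
  rw [hasFDerivAt_iff_isLittleO]
  refine (Asymptotics.IsBigO.of_bound (2 * LH) (g := fun z' => ‖z' - z‖ ^ 2)
    (.of_forall fun z' => ?_)).trans_isLittleO ?_
  · simpa using hbound z'
  · exact Asymptotics.isLittleO_pow_sub_sub z one_lt_two

/-- Existence of the fundamental solution along a trajectory, together with its identification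
with the derivatives of the flow. -/
theorem exists_isFundamentalSolution_flow (hU : ContDiff ℝ 2 U)
    (hHess : ∀ x, ‖fderiv ℝ (gradient U) x‖ ≤ 1)
    {LH : ℝ} (hLH : 0 ≤ LH) (hHessLip : ∀ x x' : Ed d,
      frobNorm (fderiv ℝ (gradient U) x - fderiv ℝ (gradient U) x') ≤ LH * ‖x - x'‖)
    (ht0 : 0 < t) (ht : t ≤ 1 / 4) (hΦ0 : ∀ z, Φ 0 z = z)
    (hΦ : ∀ z s, HasDerivAt (fun u => Φ u z) ((Φ s z).2, -gradient U (Φ s z).1) s)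
    (x v : Ed d) : ∃ A B W Z : ℝ → Ed d →L[ℝ] Ed d,
      IsFundamentalSolution t (fun s => fderiv ℝ (gradient U) (Φ s (x, v)).1) A B W Z ∧
      fderiv ℝ (Φ t) (x, v) = blockCLM (A t) (B t) (W t) (Z t) ∧
      fderiv ℝ (fun y => (Φ t (y, v)).1) x = A t ∧
      fderiv ℝ (fun w => (Φ t (x, w)).1) v = B t ∧
      fderiv ℝ (fun y => (Φ t (y, v)).2) x = W t ∧
      fderiv ℝ (fun w => (Φ t (x, w)).2) v = Z t := by
  obtain ⟨A, B, W, Z, hf⟩ := exists_isFundamentalSolution ht0 ht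
    (continuous_fderiv_gradient_flow hU hΦ (x, v)) (fun s => hHess _)
  have hd := hasFDerivAt_flow hU hHess hLH hHessLip ht0 ht hΦ0 hΦ (x, v) hf
  have hx := hd.comp x (hasFDerivAt_prodMk_left (𝕜 := ℝ) x v)
  have hv := hd.comp v (hasFDerivAt_prodMk_right (𝕜 := ℝ) x v)
  refine ⟨A, B, W, Z, hf, hd.fderiv, hx.fst.fderiv.trans ?_, hv.fst.fderiv.trans ?_,
    hx.snd.fderiv.trans ?_, hv.snd.fderiv.trans ?_⟩ <;> ext a : 1 <;> simp [blockCLM]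

end Flow

/-- Lemma 4.1, second part: Frobenius-norm Lipschitz bounds on the Jacobian of the
Hamiltonian flow under the Hessian-Lipschitz assumption. -/
theorem hamiltonian_flow_jacobian_frobenius_bounds
    {d : ℕ} (hd : 1 ≤ d) (U : Ed d → ℝ) (hU : ContDiff ℝ 2 U)
    (hHess : ∀ x, ‖fderiv ℝ (gradient U) x‖ ≤ 1)
    (LH : ℝ)
    (hHessLip : ∀ x x' : Ed d,
      frobNorm (fderiv ℝ (gradient U) x - fderiv ℝ (gradient U) x') ≤ LH * ‖x - x'‖)
    (t : ℝ) (ht0 : 0 < t) (ht : t ≤ 1 / 4)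
    (Φ : ℝ → Phase d → Phase d)
    (hΦ0 : ∀ z, Φ 0 z = z)
    (hΦ : ∀ z s, HasDerivAt (fun u => Φ u z) ((Φ s z).2, -gradient U (Φ s z).1) s) :
    ∀ x v x' v' : Ed d,
      frobNormP (fderiv ℝ (Φ t) (x, v) - EtCLM U Φ t (x, v) -
          (fderiv ℝ (Φ t) (x', v') - EtCLM U Φ t (x', v'))) ≤
        7 / 20 * LH * t ^ 3 * (2 * ‖x - x'‖ + t * ‖v - v'‖) ∧
      frobNorm (fderiv ℝ (fun y => (Φ t (y, v)).1) x - fderiv ℝ (fun y => (Φ t (y, v')).1) x') ≤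
        7 / 10 * t ^ 2 * LH * ‖x - x'‖ + 21 / 40 * t ^ 3 * LH * ‖v - v'‖ ∧
      frobNorm (fderiv ℝ (fun w => (Φ t (x, w)).1) v - fderiv ℝ (fun w => (Φ t (x', w)).1) v') ≤
        7 / 10 * t ^ 3 * LH * ‖x - x'‖ + 7 / 20 * t ^ 4 * LH * ‖v - v'‖ ∧
      frobNorm (fderiv ℝ (fun y => (Φ t (y, v)).2) x - fderiv ℝ (fun y => (Φ t (y, v')).2) x') ≤
        21 / 20 * t * LH * ‖x - x'‖ + 21 / 40 * t ^ 2 * LH * ‖v - v'‖ ∧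
      frobNorm (fderiv ℝ (fun w => (Φ t (x, w)).2) v - fderiv ℝ (fun w => (Φ t (x', w)).2) v') ≤
        21 / 40 * t ^ 2 * LH * ‖x - x'‖ + 11 / 30 * t ^ 3 * LH * ‖v - v'‖ := by
  intro x v x' v'
  have hLH : 0 ≤ LH := by
    have h := (frobNorm_nonneg _).trans (hHessLip (EuclideanSpace.single ⟨0, hd⟩ 1) 0)
    simpa using h
  have hp : 0 ≤ LH * ‖x - x'‖ := by positivity
  have hq : 0 ≤ LH * ‖v - v'‖ := by positivity
  obtain ⟨A, B, W, Z, hf, hD, hA, hB, hW, hZ⟩ :=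
    exists_isFundamentalSolution_flow hU hHess hLH hHessLip ht0 ht hΦ0 hΦ x v
  obtain ⟨A', B', W', Z', hf', hD', hA', hB', hW', hZ'⟩ :=
    exists_isFundamentalSolution_flow hU hHess hLH hHessLip ht0 ht hΦ0 hΦ x' v'
  have hHH' : ∀ s ∈ Icc 0 t, frobNorm (fderiv ℝ (gradient U) (Φ s (x, v)).1 -
      fderiv ℝ (gradient U) (Φ s (x', v')).1) ≤
      (1 + 16 / 31 * s ^ 2) * (LH * ‖x - x'‖ + LH * ‖v - v'‖ * s) := by
    intro s hs
    refine (hHessLip _ _).trans ((mul_le_mul_of_nonneg_left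
      (norm_flow_sub_le hU hHess ht hΦ0 hΦ (x, v) (x', v') hs) hLH).trans_eq ?_)
    ring
  obtain ⟨hDA, hDB, hDW, hDZ⟩ := hf.frobNorm_sub_le hf' ht0 ht (fun _ => hHess _)
    (fun _ => hHess _) hp hq hHH'
  have htt := right_mem_Icc.2 ht0.le
  rw [hD, hD', hA, hA', hB, hB', hW, hW', hZ, hZ']
  refine ⟨?_, (hDA t htt).trans ?_, (hDB t htt).trans ?_, hDW.trans_eq ?_, hDZ.trans_eq ?_⟩
  · rw [EtCLM, EtCLM, blockCLM_sub, blockCLM_sub, blockCLM_sub]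
    refine (frobNormP_blockCLM_le _ _ _ _).trans ((hf.frobNorm_remainder_sub_le hf' ht0 ht
      (continuous_fderiv_gradient_flow hU hΦ _) (continuous_fderiv_gradient_flow hU hΦ _)
      (fun _ => hHess _) (fun _ => hHess _) hp hq hHH').trans_eq ?_)
    ring
  · have h1 : 0 ≤ LH * ‖x - x'‖ * t ^ 2 := by positivity
    have h2 : 0 ≤ LH * ‖v - v'‖ * t ^ 3 := by positivity
    linarith
  · have h1 : 0 ≤ LH * ‖x - x'‖ * t ^ 3 := by positivity
    have h2 : 0 ≤ LH * ‖v - v'‖ * t ^ 4 := by positivity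
    linarith
  · ring
  · ring
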